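/- arXiv:1603.01817 — 2 statements merged into one kernel-verified Lean document; each statement's English description precedes it below -/
import Mathlib

section
/- If E̊ ∈ [0,1] is a fixed point of the underlying state evolution, i.e. T_u(E̊) = E̊, then the derivative of the underlying potential vanishes at E̊: F_u′(E̊) = 0. -/
open MeasureTheory ProbabilityTheory Filter Finset Real

noncomputable section

/-- Product of `B` i.i.d. standard Gaussians on `Fin B → ℝ` (law of `z`). -/
def stdGauss (B : ℕ) : Measure (Fin B → ℝ) :=
  Measure.pi fun _ => gaussianReal 0 1

/-- The `j`-th standard basis vector of `ℝ^B` (a section). -/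
def basisVec (B : ℕ) (j : Fin B) : Fin B → ℝ := fun k => if k = j then 1 else 0

/-- The MMSE denoiser `f_i(Σ)` of the effective Gaussian channel. -/
def denoiser (B : ℕ) (Sn : ℝ) (s z : Fin B → ℝ) (i : Fin B) : ℝ :=
  (1 + ∑ k ∈ Finset.univ.erase i,
      Real.exp ((s k - s i) * Real.logb 2 B / Sn ^ 2 +
        (z k - z i) * Real.sqrt (Real.logb 2 B) / Sn))⁻¹

/-- `E_{s,z}[ ∑_{i=1}^B (f_i(Σ) - s_i)^2 ]`, with `s` uniform over the basis vectors
and `z` i.i.d. standard Gaussian: the MMSE of the effective `B`-dimensional channel. -/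
def mmseB (B : ℕ) (Sn : ℝ) : ℝ :=
  (B : ℝ)⁻¹ * ∑ j : Fin B,
    ∫ z, (∑ i, (denoiser B Sn (basisVec B j) z i - basisVec B j i) ^ 2) ∂ stdGauss B

/-- Effective noise `Σ(E) = √(R(σ² + E))`. -/
def sigU (R σ2 E : ℝ) : ℝ := Real.sqrt (R * (σ2 + E))

/-- State evolution operator of the underlying system. -/
def Tu (B : ℕ) (R σ2 E : ℝ) : ℝ := mmseB B (sigU R σ2 E)

/-- Energy term of the underlying potential. -/
def Uu (R σ2 E : ℝ) : ℝ :=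
  (1 / (2 * R)) * Real.logb 2 ((σ2 + E) * Real.exp (-(E / (σ2 + E))))

/-- Entropy term of the underlying potential,
`S_u(Σ) = E_z[log_B(1 + ∑_{i=2}^B e_i(Σ))]`. -/
def Su (B : ℕ) (Sn : ℝ) : ℝ :=
  if h : 0 < B then
    letI : NeZero B := ⟨h.ne'⟩
    ∫ z, Real.logb B (1 + ∑ i ∈ Finset.univ.erase (0 : Fin B),
        Real.exp ((z i - z 0) * Real.sqrt (Real.logb 2 B) / Sn -
          Real.logb 2 B / Sn ^ 2)) ∂ stdGauss B
  else 0

/-- Potential of the underlying system. -/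
def Fu (B : ℕ) (R σ2 E : ℝ) : ℝ := Uu R σ2 E - Su B (sigU R σ2 E)

/-- The MSE floor `E₀ = lim_t T_u^{(t)}(0)`. -/
def mseFloor (B : ℕ) (R σ2 : ℝ) : ℝ :=
  limUnder atTop fun t : ℕ => (Tu B R σ2)^[t] 0

/-- Basin of attraction `𝒱₀` of the MSE floor. -/
def basin (B : ℕ) (R σ2 : ℝ) : Set ℝ :=
  {E | E ∈ Set.Icc (0:ℝ) 1 ∧
    Tendsto (fun t : ℕ => (Tu B R σ2)^[t] E) atTop (nhds (mseFloor B R σ2))}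

/-- Free energy gap `ΔF_u` (`+∞` if the complement of the basin is empty). -/
def gapFu (B : ℕ) (R σ2 : ℝ) : EReal :=
  ⨅ E ∈ Set.Icc (0:ℝ) 1 \ basin B R σ2,
    ((Fu B R σ2 E - Fu B R σ2 (mseFloor B R σ2) : ℝ) : EReal)

/-- Potential threshold `R_pot`. -/
def Rpot (B : ℕ) (σ2 : ℝ) : ℝ :=
  sSup {R : ℝ | 0 < R ∧ 0 < gapFu B R σ2}

/-- Effective noise `Σ_c(E)` of block `c` in the coupled system. -/
def sigC (R σ2 : ℝ) (Γ : ℕ) (J : Fin Γ → Fin Γ → ℝ) (E : Fin Γ → ℝ) (c : Fin Γ) : ℝ :=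
  (Real.sqrt ((Γ : ℝ)⁻¹ * ∑ r, J r c / (R * (σ2 + E r))))⁻¹

/-- Coupled state evolution operator `[T_c(E)]_r`. -/
def Tc (B : ℕ) (R σ2 : ℝ) (Γ : ℕ) (J : Fin Γ → Fin Γ → ℝ) (E : Fin Γ → ℝ) (r : Fin Γ) : ℝ :=
  (Γ : ℝ)⁻¹ * ∑ c, J r c * mmseB B (sigC R σ2 Γ J E c)

/-- Coupled potential `F_c`. -/
def Fc (B : ℕ) (R σ2 : ℝ) (Γ : ℕ) (J : Fin Γ → Fin Γ → ℝ) (E : Fin Γ → ℝ) : ℝ :=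
  (∑ r, Uu R σ2 (E r)) - ∑ c, Su B (sigC R σ2 Γ J E c)

/-- Shift operator: `[S(E)]_1 = E₀`, `[S(E)]_r = E_{r-1}` (0-based indexing). -/
def shiftProf (Γ : ℕ) (E0v : ℝ) (E : Fin Γ → ℝ) (r : Fin Γ) : ℝ :=
  if r.1 = 0 then E0v else E ⟨r.1 - 1, lt_of_le_of_lt (Nat.sub_le _ _) r.isLt⟩

/-- Partial derivative of a function of a profile with respect to coordinate `r`. -/
def pderiv (Γ : ℕ) (F : (Fin Γ → ℝ) → ℝ) (r : Fin Γ) (P : Fin Γ → ℝ) : ℝ :=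
  deriv (fun x => F (Function.update P r x)) (P r)

/-- Coupled SE operator with the pinning condition enforced on
`A = {1,…,3w} ∪ {Γ-3w+1,…,Γ}` (in 0-based indexing: `r < 3w` or `r ≥ Γ-3w`). -/
def TcPin (B : ℕ) (R σ2 : ℝ) (Γ w : ℕ) (J : Fin Γ → Fin Γ → ℝ) (E : Fin Γ → ℝ) (r : Fin Γ) : ℝ :=
  if r.1 < 3*w ∨ Γ - 3*w ≤ r.1 then 0 else Tc B R σ2 Γ J E r

/-- All-ones initial profile, pinned to `0` on the pinning set `A`. -/
def onesPin (Γ w : ℕ) : Fin Γ → ℝ :=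
  fun r => if r.1 < 3*w ∨ Γ - 3*w ≤ r.1 then 0 else 1

/-- Large section size (`B → ∞`) limit of the underlying potential. -/
def phiLim (R σ2 E : ℝ) : ℝ :=
  (1/(2*R)) * Real.logb 2 ((σ2 + E) * Real.exp (-(E/(σ2+E)))) -
    max 0 (1 - 1/(2 * Real.log 2 * R * (σ2 + E)))

instance (B : ℕ) : IsProbabilityMeasure (stdGauss B) := by
  unfold stdGauss; infer_instance

lemma measurePreserving_eval_stdGauss {B : ℕ} (k : Fin B) :
    MeasurePreserving (fun z : Fin B → ℝ => z k) (stdGauss B) (gaussianReal 0 1) :=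
  measurePreserving_eval (fun _ => gaussianReal 0 1) k

lemma integrable_eval_stdGauss {B : ℕ} (k : Fin B) :
    Integrable (fun z => z k) (stdGauss B) :=
  (measurePreserving_eval_stdGauss k).integrable_comp_of_integrable
    ((memLp_id_gaussianReal 1).integrable le_rfl)

lemma integral_eval_stdGauss {B : ℕ} (k : Fin B) : ∫ z, z k ∂stdGauss B = 0 := by
  have h := measurePreserving_eval_stdGauss k
  have := integral_map (μ := stdGauss B) h.measurable.aemeasurable
    (f := fun x : ℝ => x) aestronglyMeasurable_id
  rw [h.map_eq, integral_id_gaussianReal] at this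
  exact this.symm

lemma integral_comp_perm_stdGauss {B : ℕ} (e : Equiv.Perm (Fin B)) (F : (Fin B → ℝ) → ℝ) :
    ∫ z, F (z ∘ e) ∂stdGauss B = ∫ z, F z ∂stdGauss B := by
  have h := measurePreserving_piCongrLeft (α := fun _ : Fin B => ℝ)
    (fun _ => gaussianReal 0 1) e.symm
  have h' := h.integral_comp (MeasurableEquiv.measurableEmbedding _) F
  convert! h' using 4 with z
  ext i
  rw [MeasurableEquiv.coe_piCongrLeft]
  simpa using (Equiv.piCongrLeft_apply_apply (fun _ : Fin B => ℝ) e.symm z (e i)).symm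

lemma hasDerivAt_gaussianPDFReal (x : ℝ) :
    HasDerivAt (gaussianPDFReal 0 1) (-x * gaussianPDFReal 0 1 x) x := by
  have h : HasDerivAt (fun x : ℝ => -(x - 0) ^ 2 / (2 * (1 : NNReal))) (-x) x := by
    convert! (((hasDerivAt_id x).sub_const 0).pow 2).neg.div_const (2 * (1 : NNReal) : ℝ) using 1
    simp; ring
  convert! h.exp.const_mul (√(2 * π * (1 : NNReal)))⁻¹ using 1
  simp only [gaussianPDFReal]; ring

/-- Gaussian integration by parts in one dimension. -/
lemma integral_mul_gaussianReal_eq_integral_deriv {g g' : ℝ → ℝ} {C : ℝ}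
    (hg : ∀ x, HasDerivAt g (g' x) x) (hb : ∀ x, |g x| ≤ C) (hb' : ∀ x, |g' x| ≤ C) :
    ∫ x, x * g x ∂gaussianReal 0 1 = ∫ x, g' x ∂gaussianReal 0 1 := by
  have hgc : Continuous g := continuous_iff_continuousAt.2 fun x => (hg x).continuousAt
  have hg'm : Measurable g' := by
    have : g' = deriv g := funext fun x => (hg x).deriv.symm
    exact this ▸ measurable_deriv g
  have hp := integrable_gaussianPDFReal 0 1
  have hxp : Integrable fun x => -x * gaussianPDFReal 0 1 x := by
    have h := (integrable_mul_exp_neg_mul_sq (b := 1 / 2) (by norm_num)).const_mul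
      (-(√(2 * π * (1 : NNReal)))⁻¹)
    refine h.congr (.of_forall fun x => ?_)
    simp only [gaussianPDFReal, NNReal.coe_one]
    rw [show -(x - 0) ^ 2 / (2 * 1) = -(1 / 2) * x ^ 2 by ring]
    ring
  rw [integral_gaussianReal_eq_integral_smul one_ne_zero,
    integral_gaussianReal_eq_integral_smul one_ne_zero]
  have h := integral_mul_deriv_eq_deriv_mul_of_integrable (u := g) (u' := g')
    (v := gaussianPDFReal 0 1) (v' := fun x => -x * gaussianPDFReal 0 1 x)
    (fun x _ => hg x) (fun x _ => hasDerivAt_gaussianPDFReal x)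
    (hxp.bdd_mul hgc.aestronglyMeasurable (.of_forall hb))
    (hp.bdd_mul hg'm.aestronglyMeasurable (.of_forall hb'))
    (hp.bdd_mul hgc.aestronglyMeasurable (.of_forall hb))
  calc _ = -∫ x, g x * (-x * gaussianPDFReal 0 1 x) := by
        rw [← integral_neg]; congr 1; ext x; simp only [smul_eq_mul]; ring
    _ = _ := by
        rw [h, neg_neg]; congr 1; ext x; simp only [smul_eq_mul]; ring

/-- Gaussian integration by parts in the `k`-th coordinate. -/
lemma integral_eval_mul_stdGauss {B : ℕ} (k : Fin B) {φ φ' : (Fin B → ℝ) → ℝ} {C : ℝ}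
    (hφ : Measurable φ) (hφ' : Measurable φ')
    (hd : ∀ z, HasDerivAt (fun t => φ (Function.update z k t)) (φ' z) (z k))
    (hb : ∀ z, |φ z| ≤ C) (hb' : ∀ z, |φ' z| ≤ C) :
    ∫ z, z k * φ z ∂stdGauss B = ∫ z, φ' z ∂stdGauss B := by
  obtain ⟨n, rfl⟩ : ∃ n, B = n + 1 := ⟨B - 1, by have := k.2; omega⟩
  have hmp : MeasurePreserving (MeasurableEquiv.piFinSuccAbove (fun _ => ℝ) k).symm
      ((gaussianReal 0 1).prod (stdGauss n)) (stdGauss (n + 1)) :=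
    (measurePreserving_piFinSuccAbove (fun _ => gaussianReal 0 1) k).symm _
  have hint : Integrable (fun z => z k * φ z) (stdGauss (n + 1)) :=
    (integrable_eval_stdGauss k).mul_bdd hφ.aestronglyMeasurable (.of_forall hb)
  have hint' : Integrable φ' (stdGauss (n + 1)) :=
    .of_bound hφ'.aestronglyMeasurable C (.of_forall hb')
  rw [← hmp.integral_comp (MeasurableEquiv.measurableEmbedding _),
    ← hmp.integral_comp (MeasurableEquiv.measurableEmbedding _)]
  refine (integral_prod_symm _ (hmp.integrable_comp_of_integrable hint)).trans
    (Eq.trans ?_ (integral_prod_symm _ (hmp.integrable_comp_of_integrable hint')).symm)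
  congr 1
  ext y
  have hsymm (t : ℝ) : (MeasurableEquiv.piFinSuccAbove (fun _ => ℝ) k).symm (t, y)
      = Fin.insertNth k t y := rfl
  simp only [Function.comp_apply, hsymm, Fin.insertNth_apply_same]
  refine integral_mul_gaussianReal_eq_integral_deriv (fun x => ?_) (fun x => hb _)
    (fun x => hb' _)
  have := hd (Fin.insertNth k x y)
  simpa only [Fin.update_insertNth, Fin.insertNth_apply_same] using this

section Softmax

variable {ι : Type*} [Fintype ι]

def logSumExp (u : ι → ℝ) : ℝ := Real.log (∑ l, Real.exp (u l))

def softmax (u : ι → ℝ) (i : ι) : ℝ := Real.exp (u i) / ∑ l, Real.exp (u l)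

lemma sum_exp_pos [Nonempty ι] (u : ι → ℝ) : 0 < ∑ l, Real.exp (u l) :=
  Finset.sum_pos (fun _ _ => Real.exp_pos _) Finset.univ_nonempty

lemma softmax_nonneg (u : ι → ℝ) (i : ι) : 0 ≤ softmax u i := by
  unfold softmax; positivity

lemma sum_softmax [Nonempty ι] (u : ι → ℝ) : ∑ i, softmax u i = 1 := by
  simp only [softmax, ← Finset.sum_div]
  exact div_self (sum_exp_pos u).ne'

lemma softmax_le_one (u : ι → ℝ) (i : ι) : softmax u i ≤ 1 := by
  have : Nonempty ι := ⟨i⟩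
  rw [← sum_softmax u]
  exact Finset.single_le_sum (fun j _ => softmax_nonneg u j) (Finset.mem_univ i)

lemma softmax_eq_exp_sub [Nonempty ι] (u : ι → ℝ) (i : ι) :
    softmax u i = Real.exp (u i - logSumExp u) := by
  rw [logSumExp, Real.exp_sub, Real.exp_log (sum_exp_pos u), softmax]

lemma softmax_comp_perm (e : Equiv.Perm ι) (u : ι → ℝ) (i : ι) :
    softmax (u ∘ e) i = softmax u (e i) := by
  simp only [softmax, Function.comp_apply]
  rw [Equiv.sum_comp e fun l => Real.exp (u l)]

lemma one_add_sum_exp_sub [DecidableEq ι] (u : ι → ℝ) (i : ι) :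
    1 + ∑ k ∈ Finset.univ.erase i, Real.exp (u k - u i)
      = (∑ k, Real.exp (u k)) / Real.exp (u i) := by
  rw [← Finset.add_sum_erase _ _ (Finset.mem_univ i), add_div, div_self (Real.exp_ne_zero _),
    Finset.sum_div]
  simp only [Real.exp_sub]

lemma abs_logSumExp_le [Nonempty ι] (u : ι → ℝ) :
    |logSumExp u| ≤ Real.log (Fintype.card ι) + ∑ k, |u k| := by
  have hcard : (1 : ℝ) ≤ Fintype.card ι := by exact_mod_cast Fintype.card_pos
  have hS : ∀ k, |u k| ≤ ∑ k, |u k| := fun k =>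
    Finset.single_le_sum (fun j _ => abs_nonneg (u j)) (Finset.mem_univ k)
  have hlog := Real.log_nonneg hcard
  rw [abs_le]
  constructor
  · obtain ⟨k⟩ := ‹Nonempty ι›
    have h1 : Real.exp (u k) ≤ ∑ l, Real.exp (u l) :=
      Finset.single_le_sum (fun j _ => (Real.exp_pos _).le) (Finset.mem_univ k)
    have h2 := Real.log_le_log (Real.exp_pos _) h1
    rw [Real.log_exp] at h2
    have := (abs_le.1 (hS k)).1
    unfold logSumExp
    linarith
  · have h1 : ∑ l, Real.exp (u l) ≤ Fintype.card ι * Real.exp (∑ k, |u k|) := by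
      rw [← nsmul_eq_mul]
      exact Finset.sum_le_card_nsmul _ _ _ fun k _ =>
        Real.exp_le_exp.2 ((le_abs_self _).trans (hS k))
    have h2 := Real.log_le_log (sum_exp_pos u) h1
    rwa [Real.log_mul (by positivity) (Real.exp_ne_zero _), Real.log_exp] at h2

lemma hasDerivAt_logSumExp [Nonempty ι] {u : ℝ → ι → ℝ} {u' : ι → ℝ} {t : ℝ}
    (hu : ∀ k, HasDerivAt (fun t => u t k) (u' k) t) :
    HasDerivAt (fun t => logSumExp (u t)) (∑ k, softmax (u t) k * u' k) t := by
  have h := (HasDerivAt.fun_sum fun k (_ : k ∈ Finset.univ) => (hu k).exp).log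
    (sum_exp_pos (u t)).ne'
  convert! h using 1
  rw [Finset.sum_div]
  exact Finset.sum_congr rfl fun k _ => by simp only [softmax]; ring

lemma hasDerivAt_softmax [Nonempty ι] {u : ℝ → ι → ℝ} {u' : ι → ℝ} {t : ℝ}
    (hu : ∀ k, HasDerivAt (fun t => u t k) (u' k) t) (i : ι) :
    HasDerivAt (fun t => softmax (u t) i)
      (softmax (u t) i * (u' i - ∑ k, softmax (u t) k * u' k)) t := by
  simp only [softmax_eq_exp_sub _ i]
  exact ((hu i).sub (hasDerivAt_logSumExp hu)).exp

@[fun_prop]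
lemma measurable_logSumExp : Measurable (logSumExp : (ι → ℝ) → ℝ) := by
  unfold logSumExp; fun_prop

@[fun_prop]
lemma measurable_softmax (i : ι) : Measurable fun u : ι → ℝ => softmax u i := by
  unfold softmax; fun_prop

end Softmax

/-- Logits of the posterior over sections when `s + z / a` is observed. -/
def channelLogits {B : ℕ} (a : ℝ) (s z : Fin B → ℝ) : Fin B → ℝ :=
  fun k => s k * a ^ 2 + z k * a

@[fun_prop]
lemma measurable_channelLogits {B : ℕ} (a : ℝ) (s : Fin B → ℝ) :
    Measurable (channelLogits a s) := by
  unfold channelLogits; fun_prop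

lemma integral_eval_mul_softmax {B : ℕ} (a : ℝ) (s : Fin B → ℝ) (k : Fin B) :
    ∫ z, z k * softmax (channelLogits a s z) k ∂stdGauss B
      = ∫ z, a * (softmax (channelLogits a s z) k * (1 - softmax (channelLogits a s z) k))
          ∂stdGauss B := by
  have : Nonempty (Fin B) := ⟨k⟩
  refine integral_eval_mul_stdGauss k (C := 1 + |a|) (by fun_prop) (by fun_prop)
    (fun z => ?_) (fun z => ?_) (fun z => ?_)
  · have hu (l : Fin B) :
        HasDerivAt (fun t => channelLogits a s (Function.update z k t) l)
          (if l = k then a else 0) (z k) := by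
      simp only [channelLogits, Function.update_apply]
      split_ifs
      · simpa using ((hasDerivAt_id (z k)).mul_const a).const_add (s l * a ^ 2)
      · exact hasDerivAt_const _ _
    convert! hasDerivAt_softmax hu k using 1
    simp only [Function.update_eq_self, mul_ite, mul_zero, Finset.sum_ite_eq', Finset.mem_univ,
      if_true]
    ring
  · rw [abs_of_nonneg (softmax_nonneg _ _)]
    linarith [softmax_le_one (channelLogits a s z) k, abs_nonneg a]
  · have h0 := softmax_nonneg (channelLogits a s z) k
    have h1 := softmax_le_one (channelLogits a s z) k
    rw [abs_mul, abs_of_nonneg (mul_nonneg h0 (sub_nonneg.2 h1))]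
    nlinarith [abs_nonneg a, mul_nonneg h0 h0]

/-- The I-MMSE relation for the section channel. -/
lemma hasDerivAt_integral_logSumExp_sub {B : ℕ} (j : Fin B) (a : ℝ) :
    HasDerivAt
      (fun a => ∫ z, (logSumExp (channelLogits a (basisVec B j) z)
        - channelLogits a (basisVec B j) z j) ∂stdGauss B)
      (-a * ∫ z, ∑ i, (softmax (channelLogits a (basisVec B j) z) i - basisVec B j i) ^ 2
        ∂stdGauss B) a := by
  have : Nonempty (Fin B) := ⟨j⟩
  set s := basisVec B j with hs
  have hs_abs (k : Fin B) : |s k| ≤ 1 := by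
    simp only [hs, basisVec]; split_ifs <;> simp
  have hsj : s j = 1 := by simp [hs, basisVec]
  have hint (k : Fin B) := integrable_eval_stdGauss k
  have hp_int (k : Fin B) : Integrable (fun z => softmax (channelLogits a s z) k) (stdGauss B) :=
    .of_bound (Measurable.aestronglyMeasurable (by fun_prop)) 1 (.of_forall fun z => by
      rw [Real.norm_of_nonneg (softmax_nonneg _ _)]; exact softmax_le_one _ _)
  have hzp_int (k : Fin B) :
      Integrable (fun z => z k * softmax (channelLogits a s z) k) (stdGauss B) :=
    (hint k).mul_bdd (Measurable.aestronglyMeasurable (by fun_prop)) (c := 1) (.of_forall fun z => by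
      rw [Real.norm_of_nonneg (softmax_nonneg _ _)]; exact softmax_le_one _ _)
  have hpp_int (k : Fin B) : Integrable (fun z => a * (softmax (channelLogits a s z) k *
      (1 - softmax (channelLogits a s z) k))) (stdGauss B) := by
    refine Integrable.const_mul (.of_bound (Measurable.aestronglyMeasurable (by fun_prop)) 1 (.of_forall fun z => ?_)) a
    have h0 := softmax_nonneg (channelLogits a s z) k
    have h1 := softmax_le_one (channelLogits a s z) k
    rw [Real.norm_of_nonneg (mul_nonneg h0 (sub_nonneg.2 h1))]
    nlinarith
  have hlog_int : Integrable (fun z => channelLogits a s z j) (stdGauss B) :=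
    (integrable_const _).add ((hint j).mul_const a)
  have hlse_int : Integrable (fun z => logSumExp (channelLogits a s z)) (stdGauss B) := by
    refine Integrable.mono' (g := fun z => Real.log (Fintype.card (Fin B)) +
      ∑ k, |channelLogits a s z k|) ?_ (Measurable.aestronglyMeasurable (by fun_prop))
      (.of_forall fun z => abs_logSumExp_le _)
    refine (integrable_const _).add (integrable_finsetSum _ fun k _ => ?_)
    exact (((integrable_const _).add ((hint k).mul_const a)).abs)
  have hslope (b : ℝ) (z : Fin B → ℝ) (k : Fin B) :
      HasDerivAt (fun a => channelLogits a s z k) (s k * (2 * b) + z k) b := by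
    unfold channelLogits
    simpa using! ((hasDerivAt_pow 2 b).const_mul (s k)).add ((hasDerivAt_id b).const_mul (z k))
  have hslope_le {b : ℝ} (hb : b ∈ Metric.ball a 1) (z : Fin B → ℝ) (k : Fin B) :
      |s k * (2 * b) + z k| ≤ 2 * (|a| + 1) + |z k| := by
    rw [Metric.mem_ball, Real.dist_eq] at hb
    have h2b : |2 * b| ≤ 2 * (|a| + 1) := by
      rw [abs_mul, abs_two]
      have := abs_sub_abs_le_abs_sub b a
      linarith
    refine (abs_add_le _ _).trans (add_le_add_left ?_ _)
    rw [abs_mul]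
    exact (mul_le_of_le_one_left (abs_nonneg _) (hs_abs k)).trans h2b
  have hmain := (hasDerivAt_integral_of_dominated_loc_of_deriv_le (μ := stdGauss B)
    (F := fun b z => logSumExp (channelLogits b s z) - channelLogits b s z j)
    (F' := fun b z => ∑ k, softmax (channelLogits b s z) k * (s k * (2 * b) + z k)
      - (s j * (2 * b) + z j))
    (bound := fun z => ∑ k, (2 * (|a| + 1) + |z k|) + (2 * (|a| + 1) + |z j|))
    (Metric.ball_mem_nhds a one_pos)
    (.of_forall fun b => Measurable.aestronglyMeasurable (by unfold channelLogits; fun_prop))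
    (hlse_int.sub hlog_int) (Measurable.aestronglyMeasurable (by fun_prop))
    (.of_forall fun z b hb => ?_) ?_
    (.of_forall fun z b _ =>
      (hasDerivAt_logSumExp (hslope b z)).sub (hslope b z j))).2
  · convert! hmain using 1
    symm
    calc _ = ∫ z, (∑ k, (s k * (2 * a) * softmax (channelLogits a s z) k
              + z k * softmax (channelLogits a s z) k) - (2 * a + z j)) ∂stdGauss B := by
          congr 1; ext z; rw [hsj]
          congr 1
          · exact Finset.sum_congr rfl fun k _ => by ring
          · ring
      _ = ∫ z, (∑ k, (s k * (2 * a) * softmax (channelLogits a s z) k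
              + a * (softmax (channelLogits a s z) k * (1 - softmax (channelLogits a s z) k)))
              - 2 * a) ∂stdGauss B := by
          rw [integral_sub, integral_sub, integral_finsetSum, integral_finsetSum,
            integral_add (integrable_const _) (hint j), integral_eval_stdGauss, add_zero]
          · congr 1
            refine Finset.sum_congr rfl fun k _ => ?_
            rw [integral_add ((hp_int k).const_mul _) (hzp_int k),
              integral_add ((hp_int k).const_mul _) (hpp_int k), integral_eval_mul_softmax]
          · exact fun k _ => ((hp_int k).const_mul _).add (hpp_int k)
          · exact fun k _ => ((hp_int k).const_mul _).add (hzp_int k)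
          · exact integrable_finsetSum _ fun k _ => ((hp_int k).const_mul _).add (hpp_int k)
          · exact integrable_const _
          · exact integrable_finsetSum _ fun k _ => ((hp_int k).const_mul _).add (hzp_int k)
          · exact (integrable_const _).add (hint j)
      _ = _ := by
          rw [← integral_const_mul]
          congr 1; ext z
          have hsum := sum_softmax (channelLogits a s z)
          have hsq (k : Fin B) : s k ^ 2 = s k := by
            simp only [hs, basisVec]; split_ifs <;> simp
          have hs1 : ∑ k, s k = 1 := by simp [hs, basisVec]
          generalize softmax (channelLogits a s z) = p at hsum
          have : ∑ k, (s k * (2 * a) * p k + a * (p k * (1 - p k)))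
              = ∑ k, (-a * (p k - s k) ^ 2 + a * p k + a * s k) :=
            Finset.sum_congr rfl fun k _ => by linear_combination a * hsq k
          rw [this, Finset.sum_add_distrib, Finset.sum_add_distrib, ← Finset.mul_sum,
            ← Finset.mul_sum, ← Finset.mul_sum, hsum, hs1]
          ring
  · refine (abs_sub _ _).trans (add_le_add ?_ (hslope_le hb z j))
    refine (Finset.abs_sum_le_sum_abs _ _).trans (Finset.sum_le_sum fun k _ => ?_)
    rw [abs_mul, abs_of_nonneg (softmax_nonneg _ _)]
    exact (mul_le_of_le_one_left (abs_nonneg _) (softmax_le_one _ _)).trans (hslope_le hb z k)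
  · exact (integrable_finsetSum _ fun k _ => (integrable_const _).add (hint k).abs).add
      ((integrable_const _).add (hint j).abs)

lemma logb_two_natCast_nonneg (n : ℕ) : 0 ≤ Real.logb 2 n :=
  div_nonneg (Real.log_natCast_nonneg n) (Real.log_nonneg one_le_two)

lemma denoiser_eq_softmax (B : ℕ) (Sn : ℝ) (s z : Fin B → ℝ) (i : Fin B) :
    denoiser B Sn s z i = softmax (channelLogits (√(Real.logb 2 B) / Sn) s z) i := by
  have hL := logb_two_natCast_nonneg B
  have hexp (k : Fin B) :
      (s k - s i) * Real.logb 2 B / Sn ^ 2 + (z k - z i) * √(Real.logb 2 B) / Sn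
        = channelLogits (√(Real.logb 2 B) / Sn) s z k
          - channelLogits (√(Real.logb 2 B) / Sn) s z i := by
    simp only [channelLogits, div_pow, Real.sq_sqrt hL]
    ring
  simp only [denoiser, hexp, one_add_sum_exp_sub, inv_div, softmax]

lemma integral_denoiser_error_eq (B : ℕ) (Sn : ℝ) (j j' : Fin B) :
    ∫ z, (∑ i, (denoiser B Sn (basisVec B j) z i - basisVec B j i) ^ 2) ∂stdGauss B
      = ∫ z, (∑ i, (denoiser B Sn (basisVec B j') z i - basisVec B j' i) ^ 2) ∂stdGauss B := by
  rw [← integral_comp_perm_stdGauss (Equiv.swap j j')]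
  congr 1; ext z
  have hbasis : basisVec B j = basisVec B j' ∘ Equiv.swap j j' := by
    ext i
    have : Equiv.swap j j' i = j' ↔ i = j := by
      rw [Equiv.swap_apply_eq_iff, Equiv.swap_apply_right]
    simp [basisVec, this]
  have hlogits (a : ℝ) : channelLogits a (basisVec B j) (z ∘ Equiv.swap j j')
      = channelLogits a (basisVec B j') z ∘ Equiv.swap j j' := by
    rw [hbasis]; rfl
  simp only [denoiser_eq_softmax, hlogits, softmax_comp_perm]
  rw [hbasis]
  exact Equiv.sum_comp (Equiv.swap j j') fun i =>
    (softmax (channelLogits _ (basisVec B j') z) i - basisVec B j' i) ^ 2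

lemma mmseB_eq (B : ℕ) (Sn : ℝ) (j : Fin B) :
    mmseB B Sn = ∫ z, ∑ i, (softmax (channelLogits (√(Real.logb 2 B) / Sn) (basisVec B j) z) i
      - basisVec B j i) ^ 2 ∂stdGauss B := by
  have hB : (B : ℝ) ≠ 0 := Nat.cast_ne_zero.2 (Fin.pos j).ne'
  rw [mmseB, Finset.sum_congr rfl fun k _ => integral_denoiser_error_eq B Sn k j,
    Finset.sum_const, Finset.card_univ, Fintype.card_fin, nsmul_eq_mul, inv_mul_cancel_left₀ hB]
  simp only [denoiser_eq_softmax]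

lemma Su_eq {B : ℕ} [NeZero B] (Sn : ℝ) :
    Su B Sn = (∫ z, (logSumExp (channelLogits (√(Real.logb 2 B) / Sn) (basisVec B 0) z)
      - channelLogits (√(Real.logb 2 B) / Sn) (basisVec B 0) z 0) ∂stdGauss B) / Real.log B := by
  have hL := logb_two_natCast_nonneg B
  rw [Su, dif_pos (Nat.pos_of_neZero B), ← integral_div]
  congr 1; ext z
  have hsum : ∑ i ∈ Finset.univ.erase (0 : Fin B),
        Real.exp ((z i - z 0) * √(Real.logb 2 B) / Sn - Real.logb 2 B / Sn ^ 2)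
      = ∑ i ∈ Finset.univ.erase (0 : Fin B),
        Real.exp (channelLogits (√(Real.logb 2 B) / Sn) (basisVec B 0) z i
          - channelLogits (√(Real.logb 2 B) / Sn) (basisVec B 0) z 0) := by
    refine Finset.sum_congr rfl fun i hi => ?_
    congr 1
    simp only [channelLogits, basisVec, if_neg (Finset.ne_of_mem_erase hi), if_true, div_pow,
      Real.sq_sqrt hL]
    ring
  rw [hsum, one_add_sum_exp_sub, Real.logb,
    Real.log_div (sum_exp_pos _).ne' (Real.exp_ne_zero _), Real.log_exp, logSumExp]

lemma hasDerivAt_Su_sigU {B : ℕ} (hB : 2 ≤ B) {R σ2 E : ℝ} (hR : 0 < R) (hE : 0 < σ2 + E) :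
    HasDerivAt (fun E => Su B (sigU R σ2 E))
      (Tu B R σ2 E / (2 * R * Real.log 2 * (σ2 + E) ^ 2)) E := by
  have : NeZero B := ⟨by omega⟩
  have hlogB : 0 < Real.log B := Real.log_pos (by exact_mod_cast hB)
  have hlog2 : 0 < Real.log 2 := Real.log_pos one_lt_two
  have hL : 0 < Real.logb 2 B := div_pos hlogB hlog2
  have hscale (x : ℝ) : √(Real.logb 2 B) / sigU R σ2 x = √(Real.logb 2 B / (R * (σ2 + x))) :=
    (Real.sqrt_div hL.le _).symm
  have hpos : 0 < Real.logb 2 B / (R * (σ2 + E)) := by positivity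
  have hden : HasDerivAt (fun x => R * (σ2 + x)) R E := by
    simpa using ((hasDerivAt_id E).const_add σ2).const_mul R
  have hsqrt := ((hasDerivAt_const E (Real.logb 2 B)).div hden (by positivity)).sqrt hpos.ne'
  simp only [Su_eq, Tu, mmseB_eq B _ 0, hscale]
  convert! ((hasDerivAt_integral_logSumExp_sub (0 : Fin B) _).comp E hsqrt).div_const
    (Real.log B) using 1
  have hs := Real.sqrt_pos.2 hpos
  simp only [Pi.div_apply]
  generalize √(Real.logb 2 B / (R * (σ2 + E))) = a at hs ⊢
  generalize (∫ z, ∑ i, (softmax (channelLogits a (basisVec B 0) z) i - basisVec B 0 i) ^ 2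
    ∂stdGauss B) = M
  rw [Real.logb]
  field_simp
  ring

lemma hasDerivAt_Uu {R σ2 E : ℝ} (hR : 0 < R) (hE : 0 < σ2 + E) :
    HasDerivAt (Uu R σ2) (E / (2 * R * Real.log 2 * (σ2 + E) ^ 2)) E := by
  have hlog2 : 0 < Real.log 2 := Real.log_pos one_lt_two
  have hadd : HasDerivAt (fun x => σ2 + x) 1 E := (hasDerivAt_id E).const_add σ2
  have h := ((hadd.mul (((hasDerivAt_id E).div hadd hE.ne').neg.exp)).log
    (mul_pos hE (Real.exp_pos _)).ne').div_const (Real.log 2) |>.const_mul (1 / (2 * R))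
  convert! h using 1
  simp only [Pi.mul_apply, Pi.div_apply, Pi.neg_apply, id]
  have := Real.exp_ne_zero (-(E / (σ2 + E)))
  field_simp
  ring

/-- a fixed point of the underlying state evolution is a stationary
point of the underlying potential. -/
theorem stationarity_of_underlying_fixed_points
    (B : ℕ) (hB : 2 ≤ B) (R σ2 : ℝ) (hR : 0 < R) (hσ2 : 0 < σ2)
    (E : ℝ) (hE : E ∈ Set.Icc (0:ℝ) 1) (hfix : Tu B R σ2 E = E) :
    deriv (Fu B R σ2) E = 0 := by
  have hpos : 0 < σ2 + E := add_pos_of_pos_of_nonneg hσ2 hE.1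
  have h := (hasDerivAt_Uu hR hpos).sub (hasDerivAt_Su_sigU hB hR hpos)
  rw [hfix, sub_self] at h
  exact h.deriv
end
end

section
/- The coupled state evolution operator maintains degradation in space: if E ⪰ G (componentwise, E_r ≥ G_r for all r ∈ {1,…,Γ}), then T_c(E) ⪰ T_c(G), i.e. [T_c(E)]_r ≥ [T_c(G)]_r for all r. -/
open MeasureTheory ProbabilityTheory Filter Finset Real

noncomputable section

/-- A product of measures with densities has the product density. -/
lemma pi_withDensity_eq {ι : Type*} [Fintype ι] {α : ι → Type*} [∀ i, MeasurableSpace (α i)]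
    (μ : ∀ i, Measure (α i)) [∀ i, IsProbabilityMeasure (μ i)]
    {f : ∀ i, α i → ENNReal} (hf : ∀ i, Measurable (f i))
    [∀ i, SigmaFinite ((μ i).withDensity (f i))] :
    Measure.pi (fun i => (μ i).withDensity (f i)) =
      (Measure.pi μ).withDensity (fun x => ∏ i, f i (x i)) := by
  refine Measure.pi_eq fun s hs => ?_
  have hind : iIndepFun (fun i (x : ∀ i, α i) => (s i).indicator (f i) (x i)) (Measure.pi μ) :=
    iIndepFun_pi fun i => ((hf i).indicator (hs i)).aemeasurable
  have hbox : ∀ x : ∀ i, α i, (Set.univ.pi s).indicator (fun x => ∏ i, f i (x i)) x =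
      ∏ i, (s i).indicator (f i) (x i) := by
    intro x
    by_cases hx : x ∈ Set.univ.pi s
    · rw [Set.indicator_of_mem hx]
      exact Finset.prod_congr rfl fun i _ => (Set.indicator_of_mem (hx i trivial) _).symm
    · rw [Set.indicator_of_notMem hx]
      simp only [Set.mem_pi, Set.mem_univ, true_implies, not_forall] at hx
      obtain ⟨i, hi⟩ := hx
      exact (Finset.prod_eq_zero (Finset.mem_univ i) (Set.indicator_of_notMem hi _)).symm
  rw [withDensity_apply _ (MeasurableSet.univ_pi hs), ← lintegral_indicator (MeasurableSet.univ_pi hs)]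
  simp_rw [hbox]
  rw [lintegral_prod_eq_prod_lintegral_of_indepFun _ _ hind
    fun i => ((hf i).indicator (hs i)).comp (measurable_pi_apply i)]
  refine Finset.prod_congr rfl fun i _ => ?_
  rw [withDensity_apply _ (hs i), ← lintegral_indicator (hs i),
    ← (measurePreserving_eval μ i).lintegral_comp ((hf i).indicator (hs i))]

lemma gaussianReal_one_eq_withDensity (m : ℝ) :
    gaussianReal m 1 =
      (gaussianReal 0 1).withDensity (fun x => ENNReal.ofReal (Real.exp (m * x - m ^ 2 / 2))) := by
  rw [gaussianReal_of_var_ne_zero _ one_ne_zero, gaussianReal_of_var_ne_zero _ one_ne_zero,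
    ← withDensity_mul _ (by fun_prop) (by fun_prop)]
  congr 1
  ext x
  simp only [Pi.mul_apply, gaussianPDF, gaussianPDFReal]
  rw [← ENNReal.ofReal_mul (by positivity), mul_assoc _ (Real.exp _) (Real.exp _),
    ← Real.exp_add]
  congr 3
  simp
  ring

instance isProbabilityMeasure_stdGauss (B : ℕ) : IsProbabilityMeasure (stdGauss B) := by
  unfold stdGauss
  infer_instance

/-- Translating the standard Gaussian vector gives the expected exponential density. -/
lemma stdGauss_map_const_add (B : ℕ) (m : Fin B → ℝ) :
    (stdGauss B).map (fun z => m + z) = (stdGauss B).withDensity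
      (fun y => ENNReal.ofReal (∏ k, Real.exp (m k * y k - m k ^ 2 / 2))) := by
  have hmap (k : Fin B) : (gaussianReal 0 1).map (fun x => m k + x) =
      (gaussianReal 0 1).withDensity
        (fun x => ENNReal.ofReal (Real.exp (m k * x - m k ^ 2 / 2))) := by
    rw [gaussianReal_map_const_add, zero_add, gaussianReal_one_eq_withDensity]
  have (k : Fin B) : IsProbabilityMeasure ((gaussianReal 0 1).map (fun x => m k + x)) :=
    Measure.isProbabilityMeasure_map (by fun_prop)
  have (k : Fin B) : IsProbabilityMeasure ((gaussianReal 0 1).withDensity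
      (fun x => ENNReal.ofReal (Real.exp (m k * x - m k ^ 2 / 2)))) := hmap k ▸ this k
  change (Measure.pi fun _ => gaussianReal 0 1).map (fun z k => m k + z k) = _
  rw [Measure.pi_map_pi (f := fun k x => m k + x) (fun k => by fun_prop)]
  simp_rw [hmap]
  rw [pi_withDensity_eq _ (fun k => by fun_prop)]
  simp_rw [ENNReal.ofReal_prod_of_nonneg (fun k _ => (Real.exp_pos _).le)]
  rfl

/-- The standard Gaussian vector is stable under normalized independent combinations. -/
lemma measurePreserving_stdGauss_rotate (B : ℕ) {c d : ℝ} (hcd : c ^ 2 + d ^ 2 = 1) :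
    MeasurePreserving (fun p : (Fin B → ℝ) × (Fin B → ℝ) => c • p.1 + d • p.2)
      ((stdGauss B).prod (stdGauss B)) (stdGauss B) := by
  have h1 : MeasurePreserving (fun p : ℝ × ℝ => c * p.1 + d * p.2)
      ((gaussianReal 0 1).prod (gaussianReal 0 1)) (gaussianReal 0 1) := by
    refine ⟨by fun_prop, ?_⟩
    have hind : IndepFun (fun p : ℝ × ℝ => c * p.1) (fun p : ℝ × ℝ => d * p.2)
        ((gaussianReal 0 1).prod (gaussianReal 0 1)) :=
      indepFun_prod (X := fun x => c * x) (Y := fun x => d * x) (by fun_prop) (by fun_prop)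
    have hX : ((gaussianReal 0 1).prod (gaussianReal 0 1)).map (fun p : ℝ × ℝ => c * p.1) =
        gaussianReal (c * 0) (.mk (c ^ 2) (sq_nonneg _) * 1) := by
      rw [← gaussianReal_map_const_mul,
        ← (measurePreserving_fst (μ := gaussianReal 0 1) (ν := gaussianReal 0 1)).map_eq,
        Measure.map_map (by fun_prop) (by fun_prop)]
      simp [Function.comp_def]
    have hY : ((gaussianReal 0 1).prod (gaussianReal 0 1)).map (fun p : ℝ × ℝ => d * p.2) =
        gaussianReal (d * 0) (.mk (d ^ 2) (sq_nonneg _) * 1) := by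
      rw [← gaussianReal_map_const_mul,
        ← (measurePreserving_snd (μ := gaussianReal 0 1) (ν := gaussianReal 0 1)).map_eq,
        Measure.map_map (by fun_prop) (by fun_prop)]
      simp [Function.comp_def]
    have h := gaussianReal_add_gaussianReal_of_indepFun hind hX hY
    refine Eq.trans h ?_
    congr 1
    · simp
    · ext
      simpa using hcd
  exact (measurePreserving_pi _ _ (fun _ : Fin B => h1)).comp
    (measurePreserving_arrowProdEquivProdArrow ℝ ℝ (Fin B)
      (fun _ => gaussianReal 0 1) (fun _ => gaussianReal 0 1)).symm

/-- Posterior mean of the section given the channel output `y = a • s + z`. -/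
def posteriorMean (B : ℕ) (a : ℝ) (y : Fin B → ℝ) (i : Fin B) : ℝ :=
  Real.exp (a * y i) / ∑ k, Real.exp (a * y k)

/-- Squared distance of the estimate `u` to the `j`-th basis vector. -/
def sectionLoss (B : ℕ) (j : Fin B) (u : Fin B → ℝ) : ℝ := ∑ i, (u i - basisVec B j i) ^ 2

lemma denoiser_eq_posteriorMean (B : ℕ) (hB : 2 ≤ B) (Sn : ℝ) (s z : Fin B → ℝ) (i : Fin B) :
    denoiser B Sn s z i = posteriorMean B (Real.sqrt (Real.logb 2 B) / Sn)
      ((Real.sqrt (Real.logb 2 B) / Sn) • s + z) i := by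
  have hlog : 0 ≤ Real.logb 2 B := Real.logb_nonneg (by norm_num) (by exact_mod_cast by omega)
  have hsq := Real.sq_sqrt hlog
  unfold denoiser posteriorMean
  set q := Real.sqrt (Real.logb 2 B)
  have hterm (k : Fin B) : Real.exp ((s k - s i) * Real.logb 2 B / Sn ^ 2 +
      (z k - z i) * q / Sn) =
      Real.exp (q / Sn * ((q / Sn) • s + z) k) / Real.exp (q / Sn * ((q / Sn) • s + z) i) := by
    rw [← Real.exp_sub, ← hsq]
    simp only [Pi.add_apply, Pi.smul_apply, smul_eq_mul]
    ring_nf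
  simp_rw [hterm]
  rw [← Finset.add_sum_erase _ _ (Finset.mem_univ i), ← Finset.sum_div]
  field_simp

lemma mmseB_eq_s3 (B : ℕ) (hB : 2 ≤ B) (Sn : ℝ) :
    mmseB B Sn = (B : ℝ)⁻¹ * ∑ j : Fin B, ∫ z, sectionLoss B j
      (posteriorMean B (Real.sqrt (Real.logb 2 B) / Sn)
        ((Real.sqrt (Real.logb 2 B) / Sn) • basisVec B j + z)) ∂ stdGauss B := by
  simp only [mmseB, sectionLoss, denoiser_eq_posteriorMean B hB]

lemma measurable_posteriorMean (B : ℕ) (a : ℝ) : Measurable (posteriorMean B a) := by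
  unfold posteriorMean
  fun_prop

lemma measurable_sectionLoss (B : ℕ) (j : Fin B) : Measurable (sectionLoss B j) := by
  unfold sectionLoss
  fun_prop

lemma posteriorMean_mem_Icc (B : ℕ) (a : ℝ) (y : Fin B → ℝ) (i : Fin B) :
    posteriorMean B a y i ∈ Set.Icc (0 : ℝ) 1 := by
  have hle : Real.exp (a * y i) ≤ ∑ k, Real.exp (a * y k) :=
    Finset.single_le_sum (f := fun k => Real.exp (a * y k))
      (fun k _ => (Real.exp_pos _).le) (Finset.mem_univ i)
  exact ⟨div_nonneg (Real.exp_pos _).le ((Real.exp_pos _).le.trans hle),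
    div_le_one_of_le₀ hle ((Real.exp_pos _).le.trans hle)⟩

lemma norm_sectionLoss_le (B : ℕ) (j : Fin B) {u : Fin B → ℝ}
    (hu : ∀ i, u i ∈ Set.Icc (0 : ℝ) 1) : ‖sectionLoss B j u‖ ≤ B := by
  have hnn : 0 ≤ sectionLoss B j u := Finset.sum_nonneg fun i _ => sq_nonneg _
  rw [Real.norm_of_nonneg hnn]
  calc sectionLoss B j u ≤ ∑ _i : Fin B, (1 : ℝ) := by
        refine Finset.sum_le_sum fun i _ => ?_
        obtain ⟨h0, h1⟩ := hu i
        unfold basisVec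
        split_ifs <;> nlinarith
    _ = B := by simp

lemma integrable_sectionLoss {α : Type*} [MeasurableSpace α] {μ : Measure α} [IsFiniteMeasure μ]
    (B : ℕ) (j : Fin B) {g : α → Fin B → ℝ} (hg : Measurable g)
    (hg1 : ∀ y i, g y i ∈ Set.Icc (0 : ℝ) 1) : Integrable (fun y => sectionLoss B j (g y)) μ :=
  Integrable.of_bound ((measurable_sectionLoss B j).comp hg).aestronglyMeasurable B
    (Eventually.of_forall fun y => norm_sectionLoss_le B j (hg1 y))

lemma prod_exp_basisVec (B : ℕ) (a : ℝ) (j : Fin B) (y : Fin B → ℝ) :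
    ∏ k, Real.exp ((a • basisVec B j) k * y k - (a • basisVec B j) k ^ 2 / 2) =
      Real.exp (a * y j) * Real.exp (-(a ^ 2 / 2)) := by
  rw [Finset.prod_eq_single j]
  · rw [← Real.exp_add]
    simp [basisVec, sub_eq_add_neg]
  · intro k _ hk
    simp [basisVec, hk]
  · simp

lemma integral_shift_basisVec (B : ℕ) (a : ℝ) (j : Fin B) {h : (Fin B → ℝ) → ℝ}
    (hh : Measurable h) :
    ∫ z, h (a • basisVec B j + z) ∂ stdGauss B =
      ∫ y, Real.exp (a * y j) * Real.exp (-(a ^ 2 / 2)) * h y ∂ stdGauss B := by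
  rw [← integral_map (f := h) (φ := fun z => a • basisVec B j + z) (by fun_prop)
    hh.aestronglyMeasurable, stdGauss_map_const_add]
  simp_rw [prod_exp_basisVec]
  rw [integral_withDensity_eq_integral_toReal_smul (by fun_prop)
    (Eventually.of_forall fun _ => ENNReal.ofReal_lt_top)]
  simp_rw [ENNReal.toReal_ofReal (mul_nonneg (Real.exp_pos _).le (Real.exp_pos _).le), smul_eq_mul]

lemma integrable_exp_mul_coord (B : ℕ) (a : ℝ) (j : Fin B) :
    Integrable (fun y => Real.exp (a * y j)) (stdGauss B) :=
  integrable_comp_eval (μ := fun _ : Fin B => gaussianReal 0 1) (i := j)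
    (integrable_exp_mul_gaussianReal a)

/-- For nonnegative weights, the weighted quadratic loss is minimized by the normalized weights. -/
lemma sum_mul_sectionLoss_le (B : ℕ) {L : Fin B → ℝ} (hL : ∀ i, 0 < L i) (u : Fin B → ℝ) :
    ∑ j, L j * sectionLoss B j (fun i => L i / ∑ k, L k) ≤ ∑ j, L j * sectionLoss B j u := by
  have hexp (v : Fin B → ℝ) : ∑ j, L j * sectionLoss B j v =
      ∑ i, ((∑ k, L k) * v i ^ 2 - 2 * L i * v i + L i) := by
    simp only [sectionLoss, Finset.mul_sum]
    rw [Finset.sum_comm]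
    refine Finset.sum_congr rfl fun i _ => ?_
    have hterm (j : Fin B) : L j * (v i - basisVec B j i) ^ 2 =
        L j * v i ^ 2 + if i = j then L j * (1 - 2 * v i) else 0 := by
      unfold basisVec
      split_ifs <;> ring
    simp_rw [hterm]
    rw [Finset.sum_add_distrib, ← Finset.sum_mul, Finset.sum_ite_eq, if_pos (Finset.mem_univ i)]
    ring
  rw [hexp, hexp]
  refine Finset.sum_le_sum fun i _ => ?_
  have hS : 0 < ∑ k, L k := Finset.sum_pos (fun k _ => hL k) ⟨i, Finset.mem_univ i⟩
  have hdiff : (∑ k, L k) * u i ^ 2 - 2 * L i * u i + L i -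
      ((∑ k, L k) * (L i / ∑ k, L k) ^ 2 - 2 * L i * (L i / ∑ k, L k) + L i) =
      (∑ k, L k) * (u i - L i / ∑ k, L k) ^ 2 := by
    field_simp
    ring
  have := mul_nonneg hS.le (sq_nonneg (u i - L i / ∑ k, L k))
  linarith

/-- The posterior mean minimizes the mean square error. -/
lemma sum_integral_posteriorMean_le (B : ℕ) (a : ℝ) {g : (Fin B → ℝ) → Fin B → ℝ}
    (hg : Measurable g) (hg1 : ∀ y i, g y i ∈ Set.Icc (0 : ℝ) 1) :
    ∑ j, ∫ z, sectionLoss B j (posteriorMean B a (a • basisVec B j + z)) ∂ stdGauss B ≤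
      ∑ j, ∫ z, sectionLoss B j (g (a • basisVec B j + z)) ∂ stdGauss B := by
  have hInt {f : (Fin B → ℝ) → Fin B → ℝ} (hf : Measurable f)
      (hf1 : ∀ y i, f y i ∈ Set.Icc (0 : ℝ) 1) (j : Fin B) :
      Integrable (fun y => Real.exp (a * y j) * Real.exp (-(a ^ 2 / 2)) * sectionLoss B j (f y))
        (stdGauss B) :=
    ((integrable_exp_mul_coord B a j).mul_const _).mul_bdd (c := B)
      ((measurable_sectionLoss B j).comp hf).aestronglyMeasurable
      (Eventually.of_forall fun y => norm_sectionLoss_le B j (hf1 y))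
  have hrisk {f : (Fin B → ℝ) → Fin B → ℝ} (hf : Measurable f)
      (hf1 : ∀ y i, f y i ∈ Set.Icc (0 : ℝ) 1) :
      ∑ j, ∫ z, sectionLoss B j (f (a • basisVec B j + z)) ∂ stdGauss B =
        ∫ y, ∑ j, Real.exp (a * y j) * Real.exp (-(a ^ 2 / 2)) * sectionLoss B j (f y)
          ∂ stdGauss B := by
    rw [integral_finsetSum _ fun j _ => hInt hf hf1 j]
    exact Finset.sum_congr rfl fun j _ =>
      integral_shift_basisVec B a j ((measurable_sectionLoss B j).comp hf)
  have hm := measurable_posteriorMean B a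
  have hm1 := posteriorMean_mem_Icc B a
  rw [hrisk hm hm1, hrisk hg hg1]
  refine integral_mono (integrable_finsetSum _ fun j _ => hInt hm hm1 j)
    (integrable_finsetSum _ fun j _ => hInt hg hg1 j) fun y => ?_
  have h := mul_le_mul_of_nonneg_left
    (sum_mul_sectionLoss_le B (fun i => Real.exp_pos (a * y i)) (g y))
    (Real.exp_pos (-(a ^ 2 / 2))).le
  simp only [Finset.mul_sum] at h
  convert h using 2 <;> simp only [posteriorMean, sectionLoss] <;> ring

/-- The minimum mean square error decreases with the amplitude of the signal. -/
lemma sum_integral_posteriorMean_antitone (B : ℕ) {a b : ℝ} (hb : 0 ≤ b) (hba : b ≤ a)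
    (ha : 0 < a) :
    ∑ j, ∫ z, sectionLoss B j (posteriorMean B a (a • basisVec B j + z)) ∂ stdGauss B ≤
      ∑ j, ∫ z, sectionLoss B j (posteriorMean B b (b • basisVec B j + z)) ∂ stdGauss B := by
  set c := b / a
  set d := Real.sqrt (1 - c ^ 2)
  have hc1 : c ≤ 1 := div_le_one_of_le₀ hba ha.le
  have hc0 : 0 ≤ c := div_nonneg hb ha.le
  have hcd : c ^ 2 + d ^ 2 = 1 := by
    rw [Real.sq_sqrt (by nlinarith)]
    ring
  have hca : c * a = b := div_mul_cancel₀ b ha.ne'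
  have hmb := measurable_posteriorMean B b
  have hrot := measurePreserving_stdGauss_rotate B hcd
  have hI (j : Fin B) : Integrable (fun p : (Fin B → ℝ) × (Fin B → ℝ) =>
      sectionLoss B j (posteriorMean B b (c • (a • basisVec B j + p.1) + d • p.2)))
      ((stdGauss B).prod (stdGauss B)) :=
    integrable_sectionLoss B j (hmb.comp (by fun_prop)) fun _ => posteriorMean_mem_Icc B b _
  have hsplit (j : Fin B) :
      ∫ z, sectionLoss B j (posteriorMean B b (b • basisVec B j + z)) ∂ stdGauss B =
        ∫ z', ∫ z, sectionLoss B j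
          (posteriorMean B b (c • (a • basisVec B j + z) + d • z')) ∂ stdGauss B ∂ stdGauss B := by
    have hmeas : Measurable fun z => sectionLoss B j (posteriorMean B b (b • basisVec B j + z)) :=
      (measurable_sectionLoss B j).comp (hmb.comp (measurable_const_add _))
    rw [← integral_prod_symm _ (hI j)]
    conv_lhs => rw [← hrot.map_eq]
    rw [integral_map hrot.aemeasurable hmeas.aestronglyMeasurable]
    refine integral_congr_ae (Eventually.of_forall fun p => ?_)
    simp only [smul_add, smul_smul, hca, add_assoc]
  simp_rw [hsplit]
  rw [← integral_finsetSum _ fun j _ => (hI j).integral_prod_right]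
  calc _ = ∫ _z', ∑ j, ∫ z, sectionLoss B j (posteriorMean B a (a • basisVec B j + z))
        ∂ stdGauss B ∂ stdGauss B := by simp
    _ ≤ _ := integral_mono (integrable_const _)
        (integrable_finsetSum _ fun j _ => (hI j).integral_prod_right) fun z' =>
        sum_integral_posteriorMean_le B a (g := fun y => posteriorMean B b (c • y + d • z'))
          (hmb.comp (by fun_prop)) fun _ => posteriorMean_mem_Icc B b _

lemma mmseB_mono (B : ℕ) (hB : 2 ≤ B) {S S' : ℝ} (hS : 0 < S) (hSS' : S ≤ S') :
    mmseB B S ≤ mmseB B S' := by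
  have hlog : 0 < Real.logb 2 B :=
    Real.logb_pos (by norm_num) (by exact_mod_cast by omega)
  have hq := Real.sqrt_pos.2 hlog
  rw [mmseB_eq_s3 B hB, mmseB_eq_s3 B hB]
  refine mul_le_mul_of_nonneg_left ?_ (by positivity)
  exact sum_integral_posteriorMean_antitone B (div_nonneg hq.le (hS.le.trans hSS'))
    (div_le_div_of_nonneg_left hq.le hS hSS') (div_pos hq hS)

/-- the coupled SE operator maintains degradation in space. -/
theorem Tc_maintains_degradation_in_space
    (B : ℕ) (hB : 2 ≤ B) (R σ2 : ℝ) (hR : 0 < R) (hσ2 : 0 < σ2)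
    (Γ w : ℕ) (hw : 0 < w) (hΓ : 8 * w < Γ)
    (J : Fin Γ → Fin Γ → ℝ) (hJpos : ∀ r c, 0 ≤ J r c)
    (hrow : ∀ r : Fin Γ, (Γ:ℝ)⁻¹ * ∑ c, J r c = 1)
    (E G : Fin Γ → ℝ)
    (hE : ∀ r, E r ∈ Set.Icc (0:ℝ) 1) (hG : ∀ r, G r ∈ Set.Icc (0:ℝ) 1)
    (hdeg : ∀ r, G r ≤ E r) :
    ∀ r, Tc B R σ2 Γ J G r ≤ Tc B R σ2 Γ J E r := by
  intro r
  unfold Tc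
  refine mul_le_mul_of_nonneg_left (Finset.sum_le_sum fun c _ => ?_) (by positivity)
  have hΓpos : (0 : ℝ) < Γ := by exact_mod_cast by omega
  have hGpos (k : Fin Γ) : 0 < R * (σ2 + G k) := mul_pos hR (by linarith [(hG k).1])
  have hEpos (k : Fin Γ) : 0 < R * (σ2 + E k) := mul_pos hR (by linarith [(hE k).1])
  rcases (hJpos r c).eq_or_lt with h0 | hpos
  · simp [← h0]
  refine mul_le_mul_of_nonneg_left ?_ hpos.le
  have hsumE : 0 < (Γ : ℝ)⁻¹ * ∑ k, J k c / (R * (σ2 + E k)) :=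
    mul_pos (inv_pos.2 hΓpos) (Finset.sum_pos' (fun k _ => div_nonneg (hJpos k c) (hEpos k).le)
      ⟨r, Finset.mem_univ r, div_pos hpos (hEpos r)⟩)
  have hle : (Γ : ℝ)⁻¹ * ∑ k, J k c / (R * (σ2 + E k)) ≤
      (Γ : ℝ)⁻¹ * ∑ k, J k c / (R * (σ2 + G k)) := by
    refine mul_le_mul_of_nonneg_left (Finset.sum_le_sum fun k _ => ?_) (inv_pos.2 hΓpos).le
    exact div_le_div_of_nonneg_left (hJpos k c) (hGpos k)
      (mul_le_mul_of_nonneg_left (by linarith [hdeg k]) hR.le)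
  exact mmseB_mono B hB (inv_pos.2 (Real.sqrt_pos.2 (hsumE.trans_le hle)))
    (inv_anti₀ (Real.sqrt_pos.2 hsumE) (Real.sqrt_le_sqrt hle))
end
end
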